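/- Let μ and λ be nonzero real numbers. The 6-dimensional real Lie algebra with basis {x^0, x^1, x^2, X_0, X_1, X_2} and nonzero brackets [x^0,x^1] = μ x^1 − x^2, [x^0,x^2] = x^1 + μ x^2, [X_0,X_1] = −(λ/μ) X_1 + λ X_2, [X_0,X_2] = −λ X_1 − (λ/μ) X_2, [x^0,X_1] = −μ X_1 − X_2, [x^0,X_2] = X_1 − μ X_2, [x^1,X_0] = −(λ/μ) x^1 − λ x^2, [x^1,X_1] = (λ/μ) x^0 + μ X_0, [x^1,X_2] = λ x^0 − X_0, [x^2,X_0] = λ x^1 − (λ/μ) x^2, [x^2,X_1] = −λ x^0 + X_0, [x^2,X_2] = (λ/μ) x^0 + μ X_0 (all other brackets of basis elements vanish) is isomorphic, as a real Lie algebra, to so(3,1), the Lie algebra of 4×4 real matrices A satisfying Aᵀ J + J A = 0 for J = diag(−1, 1, 1, 1). -/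

import Mathlib

open Matrix

/-- The standard basis of `ℝ⁶`; the coordinates correspond to the ordered basis
`{x^0, x^1, x^2, X_0, X_1, X_2}` of the Drinfel'd double. -/
def e6 (i : Fin 6) : Fin 6 → ℝ := Pi.single i 1

/-- The Minkowski metric matrix `J = diag(−1, 1, 1, 1)`. -/
def J4 : Matrix (Fin 4) (Fin 4) ℝ := Matrix.diagonal ![-1, 1, 1, 1]

/-- The matrix of `so(3,1)` with boost `b` along the first axis, rotation `r` about it, and
components `n₂, n₃` and `m₂, m₃` along the null rotations of weight `1` and `-1` for that boost. -/
def lorentzMatrix (b r n₂ n₃ m₂ m₃ : ℝ) : Matrix (Fin 4) (Fin 4) ℝ :=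
  !![0, b, n₂ + m₂, n₃ + m₃;
     b, 0, n₂ - m₂, n₃ - m₃;
     n₂ + m₂, m₂ - n₂, 0, r;
     n₃ + m₃, m₃ - n₃, -r, 0]

theorem lorentzMatrix_mem (b r n₂ n₃ m₂ m₃ : ℝ) :
    (lorentzMatrix b r n₂ n₃ m₂ m₃)ᵀ * J4 + J4 * lorentzMatrix b r n₂ n₃ m₂ m₃ = 0 := by
  ext i j
  fin_cases i <;> fin_cases j <;> simp [lorentzMatrix, J4]

theorem eq_lorentzMatrix {A : Matrix (Fin 4) (Fin 4) ℝ} (hA : Aᵀ * J4 + J4 * A = 0) :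
    A = lorentzMatrix (A 0 1) (A 2 3) ((A 0 2 + A 1 2) / 2) ((A 0 3 + A 1 3) / 2)
      ((A 0 2 - A 1 2) / 2) ((A 0 3 - A 1 3) / 2) := by
  have h (i j) : (Aᵀ * J4 + J4 * A) i j = 0 := by rw [hA, Matrix.zero_apply]
  simp only [J4, Matrix.add_apply, Matrix.mul_diagonal, Matrix.diagonal_mul,
    Matrix.transpose_apply] at h
  ext i j
  have hij := h i j
  have hji := h j i
  fin_cases i <;> fin_cases j <;> simp [lorentzMatrix] at hij hji ⊢ <;> linarith

theorem lorentzMatrix_commutator (b r n₂ n₃ m₂ m₃ b' r' n₂' n₃' m₂' m₃' : ℝ) :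
    lorentzMatrix b r n₂ n₃ m₂ m₃ * lorentzMatrix b' r' n₂' n₃' m₂' m₃' -
        lorentzMatrix b' r' n₂' n₃' m₂' m₃' * lorentzMatrix b r n₂ n₃ m₂ m₃ =
      lorentzMatrix (2 * (n₂ * m₂' - m₂ * n₂' + n₃ * m₃' - m₃ * n₃'))
        (2 * (n₂ * m₃' - m₃ * n₂' - n₃ * m₂' + m₂ * n₃'))
        (b * n₂' - n₂ * b' + r * n₃' - n₃ * r') (b * n₃' - n₃ * b' - r * n₂' + n₂ * r')
        (m₂ * b' - b * m₂' + r * m₃' - m₃ * r') (m₃ * b' - b * m₃' - r * m₂' + m₂ * r') := by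
  ext i j
  fin_cases i <;> fin_cases j <;>
    simp [lorentzMatrix] <;> ring

/-- The isomorphism from the Drinfel'd double to `so(3,1)`, in coordinates. -/
noncomputable def doubleToLorentz (mu lam : ℝ) : (Fin 6 → ℝ) →ₗ[ℝ] Matrix (Fin 4) (Fin 4) ℝ where
  toFun v := lorentzMatrix (mu * v 0 + lam / mu * v 3) (v 0 - lam * v 3) (v 1) (v 2)
    (lam * v 4 - (lam / mu - lam * mu) / 2 * v 5) ((lam / mu - lam * mu) / 2 * v 4 + lam * v 5)
  map_add' u v := by
    ext i j
    fin_cases i <;> fin_cases j <;> simp [lorentzMatrix] <;> ring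
  map_smul' c v := by
    ext i j
    fin_cases i <;> fin_cases j <;> simp [lorentzMatrix] <;> ring

theorem doubleToLorentz_apply (mu lam : ℝ) (v : Fin 6 → ℝ) :
    doubleToLorentz mu lam v =
      lorentzMatrix (mu * v 0 + lam / mu * v 3) (v 0 - lam * v 3) (v 1) (v 2)
        (lam * v 4 - (lam / mu - lam * mu) / 2 * v 5)
        ((lam / mu - lam * mu) / 2 * v 4 + lam * v 5) :=
  rfl

theorem doubleToLorentz_injective {mu lam : ℝ} (hmu : mu ≠ 0) (hlam : lam ≠ 0) :
    Function.Injective (doubleToLorentz mu lam) := by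
  rw [injective_iff_map_eq_zero]
  intro v hv
  rw [doubleToLorentz_apply] at hv
  have h (i j) := congrFun (congrFun hv i) j
  have hb := h 0 1
  have hr := h 2 3
  have h02 := h 0 2
  have h12 := h 1 2
  have h03 := h 0 3
  have h13 := h 1 3
  simp [lorentzMatrix] at hb hr h02 h12 h03 h13
  have hpos : mu ^ 2 + 1 ≠ 0 := by positivity
  have hm₂ : lam * v 4 - (lam / mu - lam * mu) / 2 * v 5 = 0 := by linarith
  have hm₃ : (lam / mu - lam * mu) / 2 * v 4 + lam * v 5 = 0 := by linarith
  have hq : (lam ^ 2 + ((lam / mu - lam * mu) / 2) ^ 2) ≠ 0 := by positivity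
  have v0 : v 0 = 0 := by
    refine (mul_eq_zero.mp (?_ : (mu ^ 2 + 1) * v 0 = 0)).resolve_left hpos
    field_simp at hb
    linear_combination hb + hr
  have v3 : v 3 = 0 := by
    simpa [v0, hlam] using hr
  have v4 : v 4 = 0 := by
    refine (mul_eq_zero.mp (?_ : _ * v 4 = 0)).resolve_left hq
    linear_combination lam * hm₂ + (lam / mu - lam * mu) / 2 * hm₃
  have v5 : v 5 = 0 := by
    simpa [v4, hlam] using hm₃
  ext i
  fin_cases i <;> simp [v0, v3, v4, v5] <;> linarith

theorem range_doubleToLorentz {mu lam : ℝ} (hmu : mu ≠ 0) (hlam : lam ≠ 0) :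
    Set.range (doubleToLorentz mu lam) = {A | Aᵀ * J4 + J4 * A = 0} := by
  apply Set.Subset.antisymm
  · rintro _ ⟨v, rfl⟩
    exact lorentzMatrix_mem _ _ _ _ _ _
  · intro A hA
    rw [eq_lorentzMatrix hA]
    generalize A 0 1 = b, A 2 3 = r, (A 0 2 + A 1 2) / 2 = n₂, (A 0 3 + A 1 3) / 2 = n₃,
      (A 0 2 - A 1 2) / 2 = m₂, (A 0 3 - A 1 3) / 2 = m₃
    have hpos : mu ^ 2 + 1 ≠ 0 := by positivity
    have hq : lam ^ 2 + ((lam / mu - lam * mu) / 2) ^ 2 ≠ 0 := by positivity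
    refine ⟨![(mu * b + r) / (mu ^ 2 + 1), n₂, n₃, mu * (b - mu * r) / (lam * (mu ^ 2 + 1)),
      (lam * m₂ + (lam / mu - lam * mu) / 2 * m₃) / (lam ^ 2 + ((lam / mu - lam * mu) / 2) ^ 2),
      (lam * m₃ - (lam / mu - lam * mu) / 2 * m₂) / (lam ^ 2 + ((lam / mu - lam * mu) / 2) ^ 2)],
      ?_⟩
    rw [doubleToLorentz_apply]
    generalize (lam / mu - lam * mu) / 2 = q at *
    congr 1 <;> simp <;> field_simp <;> ring

theorem eq_commutator_of_single_lt {n : ℕ} {R : Type*} [Ring R] [Algebra ℝ R]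
    (br : (Fin n → ℝ) →ₗ[ℝ] (Fin n → ℝ) →ₗ[ℝ] (Fin n → ℝ)) (φ : (Fin n → ℝ) →ₗ[ℝ] R)
    (hanti : ∀ u v, br u v = -br v u)
    (h : ∀ i j : Fin n, i < j → φ (br (Pi.single i 1) (Pi.single j 1)) =
      φ (Pi.single i 1) * φ (Pi.single j 1) - φ (Pi.single j 1) * φ (Pi.single i 1))
    (u v : Fin n → ℝ) : φ (br u v) = φ u * φ v - φ v * φ u := by
  have key : br.compr₂ φ = (LinearMap.mul ℝ R).compl₁₂ φ φ -
      ((LinearMap.mul ℝ R).compl₁₂ φ φ).flip := by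
    refine (Pi.basisFun ℝ (Fin n)).ext fun i => (Pi.basisFun ℝ (Fin n)).ext fun j => ?_
    simp only [Pi.basisFun_apply, LinearMap.compr₂_apply, LinearMap.sub_apply,
      LinearMap.compl₁₂_apply, LinearMap.flip_apply, LinearMap.mul_apply']
    rcases lt_trichotomy i j with hij | rfl | hij
    · exact h i j hij
    · rw [sub_self, self_eq_neg.mp (hanti (Pi.single i 1) _), map_zero]
    · rw [hanti, map_neg, h j i hij, neg_sub]
  exact LinearMap.congr_fun (LinearMap.congr_fun key u) v

/-- The Drinfel'd double of type `(s_3(μ), s_3(1/μ))` (Table V, second column), with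
nonzero real parameters `μ` and `λ`, is isomorphic as a real Lie algebra to
`so(3,1)`, the Lie algebra of 4×4 real matrices `A` with `Aᵀ J + J A = 0` where
`J = diag(−1,1,1,1)`. -/
theorem dd_s3mu_iso_so31 (mu lam : ℝ) (hmu : mu ≠ 0) (hlam : lam ≠ 0)
    (br : (Fin 6 → ℝ) →ₗ[ℝ] (Fin 6 → ℝ) →ₗ[ℝ] (Fin 6 → ℝ))
    (hanti : ∀ u v, br u v = - br v u)
    (hjac : ∀ u v w, br u (br v w) + br v (br w u) + br w (br u v) = 0)
    (h01 : br (e6 0) (e6 1) = mu • e6 1 - e6 2)      -- [x^0, x^1] = μ x^1 − x^2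
    (h02 : br (e6 0) (e6 2) = e6 1 + mu • e6 2)      -- [x^0, x^2] = x^1 + μ x^2
    (h03 : br (e6 0) (e6 3) = 0)                     -- [x^0, X_0] = 0
    (h04 : br (e6 0) (e6 4) = (-mu) • e6 4 - e6 5)   -- [x^0, X_1] = −μ X_1 − X_2
    (h05 : br (e6 0) (e6 5) = e6 4 - mu • e6 5)      -- [x^0, X_2] = X_1 − μ X_2
    (h12 : br (e6 1) (e6 2) = 0)                     -- [x^1, x^2] = 0
    (h13 : br (e6 1) (e6 3) = (-(lam / mu)) • e6 1 - lam • e6 2)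
                                      -- [x^1, X_0] = −(λ/μ) x^1 − λ x^2
    (h14 : br (e6 1) (e6 4) = (lam / mu) • e6 0 + mu • e6 3)
                                      -- [x^1, X_1] = (λ/μ) x^0 + μ X_0
    (h15 : br (e6 1) (e6 5) = lam • e6 0 - e6 3)     -- [x^1, X_2] = λ x^0 − X_0
    (h23 : br (e6 2) (e6 3) = lam • e6 1 - (lam / mu) • e6 2)
                                      -- [x^2, X_0] = λ x^1 − (λ/μ) x^2
    (h24 : br (e6 2) (e6 4) = (-lam) • e6 0 + e6 3)  -- [x^2, X_1] = −λ x^0 + X_0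
    (h25 : br (e6 2) (e6 5) = (lam / mu) • e6 0 + mu • e6 3)
                                      -- [x^2, X_2] = (λ/μ) x^0 + μ X_0
    (h34 : br (e6 3) (e6 4) = (-(lam / mu)) • e6 4 + lam • e6 5)
                                      -- [X_0, X_1] = −(λ/μ) X_1 + λ X_2
    (h35 : br (e6 3) (e6 5) = (-lam) • e6 4 - (lam / mu) • e6 5)
                                      -- [X_0, X_2] = −λ X_1 − (λ/μ) X_2
    (h45 : br (e6 4) (e6 5) = 0) :                   -- [X_1, X_2] = 0
    ∃ φ : (Fin 6 → ℝ) →ₗ[ℝ] Matrix (Fin 4) (Fin 4) ℝ,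
      Function.Injective φ ∧
      Set.range φ = {A | Aᵀ * J4 + J4 * A = 0} ∧
      ∀ u v, φ (br u v) = φ u * φ v - φ v * φ u := by
  refine ⟨doubleToLorentz mu lam, doubleToLorentz_injective hmu hlam,
    range_doubleToLorentz hmu hlam, eq_commutator_of_single_lt br _ hanti ?_⟩
  intro i j hij
  change doubleToLorentz mu lam (br (e6 i) (e6 j)) =
    doubleToLorentz mu lam (e6 i) * doubleToLorentz mu lam (e6 j) -
      doubleToLorentz mu lam (e6 j) * doubleToLorentz mu lam (e6 i)
  rw [doubleToLorentz_apply, doubleToLorentz_apply, doubleToLorentz_apply,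
    lorentzMatrix_commutator]
  fin_cases i <;> fin_cases j <;> first
    | exact absurd hij (by decide)
    | simp only [Fin.zero_eta, Fin.mk_one, Fin.reduceFinMk, h01, h02, h03, h04, h05, h12, h13,
        h14, h15, h23, h24, h25, h34, h35, h45]
      congr 1 <;> simp [e6] <;> field_simp <;> ring
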